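/- There exists a unique matrix K : Matrix X X ℝ satisfying the KROPE fixed-point equation K = K₁ + γ • (P * K * Pᵀ); moreover this unique fixed point is positive semidefinite. -/

import Mathlib

open Matrix

section

open MeasureTheory Filter

attribute [local instance] Matrix.normedAddCommGroup Matrix.normedSpace

/-- The kernel `(x, y) ↦ volume (Ioc (a x) (b x) ∩ Ioc (a y) (b y))` is positive semidefinite. -/
theorem posSemidef_volume_Ioc_inter {X : Type*} [Finite X] (a b : X → ℝ) :
    (Matrix.of fun x y => max (min (b x) (b y) - max (a x) (a y)) 0).PosSemidef := by
  let v : X → Lp ℝ 2 (volume : Measure ℝ) := fun x =>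
    indicatorConstLp 2 (measurableSet_Ioc (a := a x) (b := b x)) measure_Ioc_lt_top.ne 1
  have hgram : (Matrix.of fun x y => max (min (b x) (b y) - max (a x) (a y)) 0) =
      Matrix.gram ℝ v := by
    ext x y
    rw [Matrix.gram_apply, L2.inner_indicatorConstLp_indicatorConstLp measurableSet_Ioc
      measurableSet_Ioc measure_Ioc_lt_top.ne measure_Ioc_lt_top.ne, Set.Ioc_inter_Ioc,
      Real.volume_real_Ioc]
    simp
  rw [hgram]
  exact Matrix.posSemidef_gram ℝ v

theorem posSemidef_one_sub_half_abs_sub {X : Type*} [Finite X] (r : X → ℝ)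
    (hr : ∀ x, |r x| ≤ 1) :
    (Matrix.of fun x y => 1 - |r x - r y| / 2).PosSemidef := by
  convert ((posSemidef_volume_Ioc_inter (fun _ => -1) r).add
    (posSemidef_volume_Ioc_inter r (fun _ => 1))).smul (one_half_pos (α := ℝ)).le using 1
  ext x y
  have hx := abs_le.1 (hr x)
  have hy := abs_le.1 (hr y)
  have hmin : -1 ≤ min (r x) (r y) := le_min hx.1 hy.1
  have hmax : max (r x) (r y) ≤ 1 := max_le hx.2 hy.2
  simp only [Matrix.smul_apply, Matrix.add_apply, Matrix.of_apply, max_self, min_self, smul_eq_mul]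
  rw [max_eq_left (by linarith), max_eq_left (by linarith)]
  linarith [max_sub_min_eq_abs (r x) (r y), abs_sub_comm (r x) (r y)]

theorem isClosed_setOf_posSemidef {X : Type*} [Fintype X] :
    IsClosed {K : Matrix X X ℝ | K.PosSemidef} := by
  simp only [Matrix.posSemidef_iff_dotProduct_mulVec, Set.ofPred_and, Set.ofPred_forall]
  refine (isClosed_eq (by fun_prop) continuous_id).inter (isClosed_iInter fun v => ?_)
  exact isClosed_le continuous_const (by fun_prop)

theorem abs_sum_mul_le_of_sum_eq_one {X : Type*} [Fintype X] {p v : X → ℝ} {c : ℝ}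
    (hp : ∀ x, 0 ≤ p x) (hsum : ∑ x, p x = 1) (hv : ∀ x, |v x| ≤ c) :
    |∑ x, p x * v x| ≤ c :=
  calc |∑ x, p x * v x| ≤ ∑ x, |p x * v x| := Finset.abs_sum_le_sum_abs _ _
    _ ≤ ∑ x, p x * c := Finset.sum_le_sum fun x _ => by
        rw [abs_mul, abs_of_nonneg (hp x)]
        exact mul_le_mul_of_nonneg_left (hv x) (hp x)
    _ = c := by rw [← Finset.sum_mul, hsum, one_mul]

/-- Conjugation by a row-stochastic matrix does not increase the entrywise sup norm. -/
theorem norm_mul_mul_transpose_le {X : Type*} [Fintype X] {P : Matrix X X ℝ}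
    (hPnn : ∀ x y, 0 ≤ P x y) (hProw : ∀ x, ∑ y, P x y = 1) (K : Matrix X X ℝ) :
    ‖P * K * Pᵀ‖ ≤ ‖K‖ := by
  refine (Matrix.norm_le_iff (norm_nonneg K)).2 fun x y => ?_
  rw [Matrix.mul_apply, Real.norm_eq_abs]
  simp only [Matrix.transpose_apply, mul_comm _ (P y _)]
  refine abs_sum_mul_le_of_sum_eq_one (hPnn y) (hProw y) fun z => ?_
  rw [Matrix.mul_apply]
  exact abs_sum_mul_le_of_sum_eq_one (hPnn x) (hProw x) fun w =>
    Matrix.norm_entry_le_entrywise_sup_norm K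

theorem contractingWith_add_smul_mul_mul_transpose {X : Type*} [Fintype X] {γ : ℝ}
    (hγ0 : 0 ≤ γ) (hγ1 : γ < 1) {P : Matrix X X ℝ}
    (hPnn : ∀ x y, 0 ≤ P x y) (hProw : ∀ x, ∑ y, P x y = 1) (K₁ : Matrix X X ℝ) :
    ContractingWith ⟨γ, hγ0⟩ fun K : Matrix X X ℝ => K₁ + γ • (P * K * Pᵀ) := by
  refine ⟨by exact_mod_cast hγ1, LipschitzWith.of_dist_le_mul fun A B => ?_⟩
  have hsub : K₁ + γ • (P * A * Pᵀ) - (K₁ + γ • (P * B * Pᵀ)) = γ • (P * (A - B) * Pᵀ) := by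
    rw [Matrix.mul_sub, Matrix.sub_mul, smul_sub]
    abel
  rw [dist_eq_norm, dist_eq_norm, hsub, norm_smul, Real.norm_of_nonneg hγ0]
  exact mul_le_mul_of_nonneg_left (norm_mul_mul_transpose_le hPnn hProw _) hγ0

/-- **Existence, uniqueness, and positive semidefiniteness of the KROPE kernel.**
There is a unique matrix `K` satisfying the KROPE fixed-point equation
`K = K₁ + γ • (P * K * Pᵀ)`, and this unique fixed point is positive
semidefinite. -/
theorem krope_fixed_point_exists_unique_posSemidef
    {X : Type*} [Fintype X] [Nonempty X] [DecidableEq X]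
    (γ : ℝ) (hγ0 : 0 ≤ γ) (hγ1 : γ < 1)
    (P : Matrix X X ℝ) (hPnn : ∀ x y, 0 ≤ P x y) (hProw : ∀ x, ∑ y, P x y = 1)
    (r : X → ℝ) (hr : ∀ x, |r x| ≤ 1)
    (K₁ : Matrix X X ℝ) (hK₁ : ∀ x y, K₁ x y = 1 - |r x - r y| / 2) :
    (∃! K : Matrix X X ℝ, K = K₁ + γ • (P * K * Pᵀ)) ∧
      (∀ K : Matrix X X ℝ, K = K₁ + γ • (P * K * Pᵀ) → K.PosSemidef) := by
  have hf := contractingWith_add_smul_mul_mul_transpose hγ0 hγ1 hPnn hProw K₁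
  have hK₁psd : K₁.PosSemidef := by
    convert posSemidef_one_sub_half_abs_sub r hr using 1
    exact Matrix.ext hK₁
  refine ⟨⟨hf.fixedPoint, hf.fixedPoint_isFixedPt.symm, fun K hK => hf.fixedPoint_unique hK.symm⟩,
    fun K hK => ?_⟩
  rw [hf.fixedPoint_unique (x := K) hK.symm]
  refine isClosed_setOf_posSemidef.mem_of_tendsto (hf.tendsto_iterate_fixedPoint 0)
    (Eventually.of_forall fun n => ?_)
  induction n with
  | zero => exact Matrix.PosSemidef.zero
  | succ n ih =>
    rw [Function.iterate_succ_apply']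
    refine hK₁psd.add (Matrix.PosSemidef.smul ?_ hγ0)
    simpa using Matrix.PosSemidef.mul_mul_conjTranspose_same ih P

end
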